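/- Let n ≥ 2, let g : ℝⁿ → (0,∞) be a positive C² function, and let u : B̄₁(0) → ℝ be convex and continuous with u(0) = 0 and u(x) > 0 for x ≠ 0. Assume u is strictly convex on B₁(0), that u is C⁴ on B₁(0)∖{0} and satisfies det D²u(x) = g(Du(x)) for all x ∈ B₁(0)∖{0}, and that there exists a convex function φ : ℝⁿ → ℝ, positively homogeneous of degree 1, such that φ ≤ u on B₁(0) and (u(x) − φ(x))/|x| → 0 as x → 0. Then there exists a constant C > 0 such that for every x ∈ ℝⁿ∖{0}, every unit vector ξ ∈ ℝⁿ, and every 0 < ε ≤ |x|/2, one has φ(x + εξ) + φ(x − εξ) − 2φ(x) ≤ C ε² / |x|. -/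

import Mathlib

open MeasureTheory
open scoped ENNReal

noncomputable section

/-- Euclidean n-space. -/
abbrev Eu (n : ℕ) := EuclideanSpace ℝ (Fin n)

/-- Partial derivative ∂ψ/∂xᵢ. -/
def pd {n : ℕ} (ψ : Eu n → ℝ) (i : Fin n) (x : Eu n) : ℝ :=
  fderiv ℝ ψ x (EuclideanSpace.single i 1)

/-- Second partial derivative ∂²ψ/∂xᵢ∂xⱼ. -/
def pd2 {n : ℕ} (ψ : Eu n → ℝ) (i j : Fin n) (x : Eu n) : ℝ :=
  pd (pd ψ j) i x

lemma hasDerivAt_det {ι : Type*} [Fintype ι] [DecidableEq ι] {A : ℝ → Matrix ι ι ℝ}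
    {A' : Matrix ι ι ℝ} {t : ℝ} (h : ∀ i j, HasDerivAt (fun s => A s i j) (A' i j) t) :
    HasDerivAt (fun s => (A s).det) ((A t).adjugate * A').trace t := by
  have h1 : HasDerivAt (fun s => (A s).det) (∑ σ : Equiv.Perm ι, (Equiv.Perm.sign σ : ℝ) *
      ∑ i, (∏ j ∈ Finset.univ.erase i, A t (σ j) j) * A' (σ i) i) t := by
    simp only [Matrix.det_apply']
    refine HasDerivAt.fun_sum fun σ _ => HasDerivAt.const_mul _ ?_
    have := HasDerivAt.fun_finsetProd (u := Finset.univ) (f := fun j s => A s (σ j) j)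
      (f' := fun j => A' (σ j) j) (x := t) (fun j _ => h _ _)
    simpa using this
  convert h1 using 1
  have h2 : ∀ i, ((A t).adjugate * A') i i = ((A t).updateCol i (fun k => A' k i)).det := by
    intro i
    rw [← Matrix.cramer_apply, Matrix.cramer_eq_adjugate_mulVec]
    rfl
  simp only [Matrix.trace, Matrix.diag, h2, Matrix.det_apply', Finset.mul_sum]
  rw [Finset.sum_comm]
  refine Finset.sum_congr rfl fun σ _ => Finset.sum_congr rfl fun i _ => ?_
  rw [← Finset.prod_erase_mul _ _ (Finset.mem_univ i)]
  congr 2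
  · refine Finset.prod_congr rfl fun j hj => ?_
    rw [Matrix.updateCol_ne (Finset.ne_of_mem_erase hj)]
  · simp

lemma differentiableAt_det {ι : Type*} [Fintype ι] [DecidableEq ι] {A : ℝ → Matrix ι ι ℝ}
    {t : ℝ} (h : ∀ i j, DifferentiableAt ℝ (fun s => A s i j) t) :
    DifferentiableAt ℝ (fun s => (A s).det) t :=
  (hasDerivAt_det (A' := Matrix.of fun i j => deriv (fun s => A s i j) t)
    fun i j => (h i j).hasDerivAt).differentiableAt

lemma differentiableAt_inv_apply {ι : Type*} [Fintype ι] [DecidableEq ι] {A : ℝ → Matrix ι ι ℝ}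
    {t : ℝ} (h : ∀ i j, DifferentiableAt ℝ (fun s => A s i j) t) (hdet : (A t).det ≠ 0)
    (i j : ι) : DifferentiableAt ℝ (fun s => (A s)⁻¹ i j) t := by
  simp only [Matrix.inv_def, Matrix.smul_apply, Ring.inverse_eq_inv', smul_eq_mul]
  refine ((differentiableAt_det h).inv hdet).mul ?_
  simp only [Matrix.adjugate_apply]
  refine differentiableAt_det fun k l => ?_
  by_cases hk : k = j
  · subst hk; simp
  · simpa [Matrix.updateRow_ne hk] using h k l

/-- First two derivatives of the logarithm of the determinant along a curve of matrices which is
diagonal at time `0`. -/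
lemma log_det_derivatives {ι : Type*} [Fintype ι] [DecidableEq ι] {A A' : ℝ → Matrix ι ι ℝ}
    {A'' : Matrix ι ι ℝ} {lam : ι → ℝ} (hlam : ∀ i, 0 < lam i)
    (hA0 : A 0 = Matrix.diagonal lam)
    (hA : ∀ᶠ t in nhds (0 : ℝ), ∀ i j, HasDerivAt (fun s => A s i j) (A' t i j) t)
    (hA' : ∀ i j, HasDerivAt (fun s => A' s i j) (A'' i j) 0)
    {h h' : ℝ → ℝ} {h'' : ℝ} (hh : ∀ᶠ t in nhds (0 : ℝ), HasDerivAt h (h' t) t)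
    (hh' : HasDerivAt h' h'' 0)
    (heq : ∀ᶠ t in nhds (0 : ℝ), (A t).det = Real.exp (h t)) :
    h' 0 = ∑ i, A' 0 i i / lam i ∧
    h'' = ∑ i, A'' i i / lam i - ∑ i, ∑ j, A' 0 i j * A' 0 j i / (lam i * lam j) := by
  have key : ∀ᶠ t in nhds (0 : ℝ), h' t = ((A t)⁻¹ * A' t).trace := by
    filter_upwards [hA, hh, heq.eventually_nhds] with t h1 h2 h3
    have h4 := hasDerivAt_det h1
    have h5 := h4.unique (h2.exp.congr_of_eventuallyEq h3)
    have h6 := h3.self_of_nhds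
    have : (A t).det ≠ 0 := by rw [h6]; positivity
    rw [Matrix.inv_def, Matrix.smul_mul, Matrix.trace_smul, h5, Ring.inverse_eq_inv', h6,
      smul_eq_mul]
    field_simp
  have hinv0 : (A 0)⁻¹ = Matrix.diagonal fun i => (lam i)⁻¹ := by
    rw [hA0]
    apply Matrix.inv_eq_right_inv
    rw [Matrix.diagonal_mul_diagonal, ← Matrix.diagonal_one]
    congr 1; ext i; exact mul_inv_cancel₀ (hlam i).ne'
  have hdet0 : (A 0).det ≠ 0 := by rw [heq.self_of_nhds]; positivity
  have hA0d := hA.self_of_nhds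
  have hX := fun i j => (differentiableAt_inv_apply
    (fun i j => (hA0d i j).differentiableAt) hdet0 i j).hasDerivAt
  have hXval : ∀ i j, deriv (fun s => (A s)⁻¹ i j) 0 = - (A' 0 i j / (lam i * lam j)) := by
    intro i j
    have e1 : (fun s => ∑ k, A s i k * (A s)⁻¹ k j) =ᶠ[nhds 0]
        fun _ => (1 : Matrix ι ι ℝ) i j := by
      filter_upwards [heq] with t ht
      have : IsUnit (A t).det := by rw [ht]; exact (Real.exp_pos _).ne'.isUnit
      rw [← Matrix.mul_nonsing_inv _ this, Matrix.mul_apply]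
    have e2 : HasDerivAt (fun s => ∑ k, A s i k * (A s)⁻¹ k j)
        (∑ k, (A' 0 i k * (A 0)⁻¹ k j + A 0 i k * deriv (fun s => (A s)⁻¹ k j) 0)) 0 :=
      HasDerivAt.fun_sum fun k _ => (hA0d i k).mul (hX k j)
    have e3 := e2.unique ((hasDerivAt_const (0 : ℝ) _).congr_of_eventuallyEq e1)
    rw [Finset.sum_add_distrib, hinv0, hA0] at e3
    simp only [Matrix.diagonal_apply, mul_ite, ite_mul, mul_zero, zero_mul, Finset.sum_ite_eq,
      Finset.sum_ite_eq', Finset.mem_univ, if_true] at e3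
    have hi := (hlam i).ne'
    have hj := (hlam j).ne'
    field_simp at e3 ⊢
    linarith
  constructor
  · rw [key.self_of_nhds, hinv0]
    simp [Matrix.trace, Matrix.diagonal_mul, div_eq_inv_mul]
  · have e1 : HasDerivAt (fun t => ∑ i, ∑ j, (A t)⁻¹ i j * A' t j i)
        (∑ i, ∑ j, (deriv (fun s => (A s)⁻¹ i j) 0 * A' 0 j i + (A 0)⁻¹ i j * A'' j i)) 0 :=
      HasDerivAt.fun_sum fun i _ => HasDerivAt.fun_sum fun j _ => (hX i j).mul (hA' j i)
    have e2 := hh'.unique (e1.congr_of_eventuallyEq (by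
      filter_upwards [key] with t ht
      rw [ht]; simp [Matrix.trace, Matrix.mul_apply]))
    rw [e2, hinv0]
    simp only [hXval, Finset.sum_add_distrib, Matrix.diagonal_apply, ite_mul, zero_mul,
      Finset.sum_ite_eq, Finset.mem_univ, if_true]
    rw [add_comm, sub_eq_add_neg, ← Finset.sum_neg_distrib]
    congr 1
    · exact Finset.sum_congr rfl fun i _ => by ring
    · refine Finset.sum_congr rfl fun i _ => ?_
      rw [← Finset.sum_neg_distrib]
      exact Finset.sum_congr rfl fun j _ => by ring

lemma IsLocalMax.second_deriv_nonpos {f f' : ℝ → ℝ} {f'' : ℝ} {x : ℝ} (hmax : IsLocalMax f x)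
    (hf : ∀ᶠ t in nhds x, HasDerivAt f (f' t) t) (hf' : HasDerivAt f' f'' x) :
    f' x = 0 ∧ f'' ≤ 0 := by
  have h0 : f' x = 0 := hmax.hasDerivAt_eq_zero hf.self_of_nhds
  refine ⟨h0, ?_⟩
  by_contra! hpos
  have hd : deriv f =ᶠ[nhds x] f' := hf.mono fun t ht => ht.deriv
  have hdd : deriv (deriv f) x = f'' := by rw [hd.deriv_eq, hf'.deriv]
  have hmin := isLocalMin_of_deriv_deriv_pos (f := f) (x₀ := x) (by rw [hdd]; exact hpos)
    (by rw [hd.self_of_nhds, h0]) hf.self_of_nhds.continuousAt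
  have hc : f =ᶠ[nhds x] fun _ => f x := by
    filter_upwards [hmax, hmin] with t h1 h2 using le_antisymm h1 h2
  have : deriv f =ᶠ[nhds x] fun _ => 0 := by
    have := hc.deriv
    simpa using this
  rw [this.deriv_eq] at hdd
  simp at hdd
  linarith


/-- The algebra behind Pogorelov's estimate, at a point where the Hessian is diagonal. -/
lemma pogorelov_algebra {ι : Type*} [Fintype ι] [DecidableEq ι] (i₀ : ι) {lam e a c S Q : ι → ℝ}
    {V W : ι → ι → ℝ} {η β d K : ℝ} (hlam : ∀ i, 0 < lam i) (hη : 0 < η) (hβ : 0 ≤ β)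
    (hβd : 1 ≤ β + d) (he : ∀ i, |e i| ≤ K) (ha : ∀ i, |a i| ≤ K) (hc : ∀ i, |c i| ≤ K)
    (hVsymm : ∀ i j, V i j = V j i) (hVS : ∀ i, V i i₀ = S i)
    (hfirst : ∀ i, e i / η + S i / lam i₀ + β * (a i * lam i) = 0)
    (hsecond : ∀ i, -lam i / η - e i ^ 2 / η ^ 2 + Q i / lam i₀ - S i ^ 2 / lam i₀ ^ 2 +
      β * (lam i ^ 2 + ∑ k, a k * W i k) ≤ 0)
    (heq1 : ∀ l, ∑ i, W i l / lam i = lam l * c l)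
    (heq2 : ∑ i, Q i / lam i - ∑ i, ∑ j, V i j * V j i / (lam i * lam j) =
      lam i₀ ^ 2 * d + ∑ l, S l * c l) :
    η * lam i₀ ≤ Fintype.card ι * (1 + K ^ 2 + 2 * β * K ^ 2) + K := by
  set L := lam i₀ with hL
  have hLpos : 0 < L := hlam i₀
  have hK : 0 ≤ K := (abs_nonneg _).trans (he i₀)
  have hprod : ∀ x y : ℝ, |x| ≤ K → |y| ≤ K → |x * y| ≤ K ^ 2 := fun x y hx hy => by
    rw [abs_mul, sq]; exact mul_le_mul hx hy (abs_nonneg _) hK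
  have hV : ∑ i, S i ^ 2 / (L * lam i) + ∑ i ∈ Finset.univ.erase i₀, S i ^ 2 / (L * lam i) ≤
      ∑ i, ∑ j, V i j * V j i / (lam i * lam j) := by
    rw [← Finset.add_sum_erase _ (fun i => ∑ j, V i j * V j i / (lam i * lam j))
      (Finset.mem_univ i₀)]
    refine add_le_add (Finset.sum_le_sum fun i _ => ?_) (Finset.sum_le_sum fun i _ => ?_)
    · rw [hVsymm i₀ i, hVS, ← sq]
    · refine le_trans (le_of_eq ?_) (Finset.single_le_sum
        (f := fun j => V i j * V j i / (lam i * lam j)) (fun j _ => ?_) (Finset.mem_univ i₀))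
      · simp only [hVsymm i₀ i, hVS]; rw [← sq, mul_comm L]
      · rw [hVsymm j i]
        exact div_nonneg (mul_self_nonneg _) (mul_pos (hlam _) (hlam _)).le
  have hsum : ∑ i, (-1 / η - e i ^ 2 / η ^ 2 / lam i + Q i / lam i / L
      - S i ^ 2 / (L * lam i) / L + β * lam i + β * ∑ k, a k * (W i k / lam i)) ≤ 0 := by
    refine Finset.sum_nonpos fun i _ => ?_
    have h1 := div_nonpos_of_nonpos_of_nonneg (hsecond i) (hlam i).le
    have hi := (hlam i).ne'
    have h3 : ∑ k, a k * (W i k / lam i) = (∑ k, a k * W i k) / lam i := by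
      rw [Finset.sum_div]; exact Finset.sum_congr rfl fun k _ => by ring
    rw [h3]
    refine le_trans (le_of_eq ?_) h1
    field_simp
    ring
  have hW : ∑ i, ∑ k, a k * (W i k / lam i) = ∑ k, a k * (lam k * c k) := by
    rw [Finset.sum_comm]
    refine Finset.sum_congr rfl fun k _ => ?_
    rw [← Finset.mul_sum, heq1]
  simp only [Finset.sum_add_distrib, Finset.sum_sub_distrib, ← Finset.mul_sum, ← Finset.sum_div,
    hW] at hsum
  have hQ : (∑ i, S i ^ 2 / (L * lam i)) / L
      + (∑ i ∈ Finset.univ.erase i₀, S i ^ 2 / (L * lam i)) / L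
      + L * d + ∑ l, S l / L * c l ≤ (∑ i, Q i / lam i) / L := by
    have h1 : ∑ i, S i ^ 2 / (L * lam i)
      + ∑ i ∈ Finset.univ.erase i₀, S i ^ 2 / (L * lam i)
      + L ^ 2 * d + ∑ l, S l * c l ≤ ∑ i, Q i / lam i := by linarith
    have h2 := div_le_div_of_nonneg_right h1 hLpos.le
    refine le_trans (le_of_eq ?_) h2
    have h3 : ∑ l, S l / L * c l = (∑ l, S l * c l) / L := by
      rw [Finset.sum_div]; exact Finset.sum_congr rfl fun k _ => by ring
    rw [h3]
    field_simp
  have hcross : -(Fintype.card ι * (K ^ 2 / η)) ≤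
      ∑ l, S l / L * c l + β * ∑ k, a k * (lam k * c k) := by
    rw [Finset.mul_sum, ← Finset.sum_add_distrib, ← Finset.card_univ, ← nsmul_eq_mul, ← smul_neg]
    refine Finset.card_nsmul_le_sum _ _ _ fun l _ => ?_
    have h1 : S l / L * c l + β * (a l * (lam l * c l)) = -((e l * c l) / η) := by
      linear_combination c l * hfirst l
    rw [h1]
    have := (abs_le.1 (hprod _ _ (he l) (hc l))).2
    gcongr
  have hrest : -(Fintype.card ι * (2 * β * K ^ 2 / η)) ≤
      (∑ i ∈ Finset.univ.erase i₀, S i ^ 2 / (L * lam i)) / L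
      - ∑ i ∈ Finset.univ.erase i₀, e i ^ 2 / η ^ 2 / lam i := by
    rw [Finset.sum_div, ← Finset.sum_sub_distrib]
    have h0 : -(Fintype.card ι * (2 * β * K ^ 2 / η)) ≤
        (Finset.univ.erase i₀).card • (-(2 * β * K ^ 2 / η)) := by
      rw [nsmul_eq_mul, mul_neg, neg_le_neg_iff]
      have : (Finset.univ.erase i₀).card ≤ Fintype.card ι := Finset.card_le_univ _
      gcongr
    refine h0.trans (Finset.card_nsmul_le_sum _ _ _ fun i _ => ?_)
    have hi := hlam i
    have h1 : S i / L = -(e i / η) - β * (a i * lam i) := by linarith [hfirst i]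
    have h2 : S i ^ 2 / (L * lam i) / L - e i ^ 2 / η ^ 2 / lam i
        = 2 * β * (a i * e i) / η + β ^ 2 * a i ^ 2 * lam i := by
      have : S i ^ 2 / (L * lam i) / L = (S i / L) ^ 2 / lam i := by field_simp
      rw [this, h1]
      field_simp
      ring
    rw [h2]
    have h3 := (abs_le.1 (hprod _ _ (ha i) (he i))).1
    have h4 : -(2 * β * K ^ 2 / η) ≤ 2 * β * (a i * e i) / η := by
      rw [← neg_div, ← mul_neg]
      gcongr
    have : 0 ≤ β ^ 2 * a i ^ 2 * lam i := by positivity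
    linarith
  have hsplit := Finset.add_sum_erase Finset.univ (fun i => e i ^ 2 / η ^ 2 / lam i)
    (Finset.mem_univ i₀)
  have hlamsum : β * L ≤ β * ∑ i, lam i :=
    mul_le_mul_of_nonneg_left
      (Finset.single_le_sum (fun i _ => (hlam i).le) (Finset.mem_univ i₀)) hβ
  have he0 : e i₀ ^ 2 / η ^ 2 / L ≤ K ^ 2 / η ^ 2 / L := by
    have : e i₀ ^ 2 ≤ K ^ 2 := sq_le_sq' (abs_le.1 (he i₀)).1 (abs_le.1 (he i₀)).2
    gcongr
  have hLd : L ≤ (β + d) * L := le_mul_of_one_le_left hLpos.le hβd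
  set N : ℝ := (Fintype.card ι : ℝ) with hN
  have hone : (∑ _i : ι, (-1 : ℝ)) / η = -(N / η) := by
    simp [hN]; ring
  simp only [← hL] at hsplit
  have hfin : L ≤ N * (1 + K ^ 2 + 2 * β * K ^ 2) / η + K ^ 2 / η ^ 2 / L := by
    have : N * (1 + K ^ 2 + 2 * β * K ^ 2) / η
      = N / η + N * (K ^ 2 / η) + N * (2 * β * K ^ 2 / η) := by ring
    rw [this]
    rw [hone] at hsum
    linarith
  set B := N * (1 + K ^ 2 + 2 * β * K ^ 2) with hB
  have hBnn : 0 ≤ B := by positivity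
  have hM : (η * L) ^ 2 ≤ B * (η * L) + K ^ 2 := by
    have := mul_le_mul_of_nonneg_left hfin (show 0 ≤ η ^ 2 * L by positivity)
    have h2 : η ^ 2 * L * (B / η + K ^ 2 / η ^ 2 / L) = B * (η * L) + K ^ 2 := by field_simp
    rw [h2] at this
    linarith
  by_contra! hcon
  have : 0 < η * L := by positivity
  nlinarith

section DirectionalDerivatives

variable {E : Type*} [NormedAddCommGroup E] [NormedSpace ℝ E]

/-- The derivative of `f` in the direction `v`, as a function of the base point. -/
def dirD (v : E) (f : E → ℝ) (x : E) : ℝ := fderiv ℝ f x v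

lemma ContDiffAt.dirD {m : ℕ} {f : E → ℝ} {x : E} (hf : ContDiffAt ℝ (m + 1 : ℕ) f x) (v : E) :
    ContDiffAt ℝ m (dirD v f) x :=
  (hf.fderiv_right (m := m) (by norm_cast)).clm_apply contDiffAt_const

lemma dirD_smul (c : ℝ) (v : E) (f : E → ℝ) (x : E) : dirD (c • v) f x = c * dirD v f x := by
  simp [dirD]

lemma dirD_sum_smul {ι : Type*} [Fintype ι] (c : ι → ℝ) (b : ι → E) (f : E → ℝ) (x : E) :
    dirD (∑ k, c k • b k) f x = ∑ k, c k * dirD (b k) f x := by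
  simp [dirD, map_sum]

lemma hasDerivAt_comp_curve {f : E → ℝ} {c : ℝ → E} {v : E} {t : ℝ}
    (hf : DifferentiableAt ℝ f (c t)) (hc : HasDerivAt c v t) :
    HasDerivAt (fun s => f (c s)) (dirD v f (c t)) t :=
  hf.hasFDerivAt.comp_hasDerivAt t hc

lemma hasDerivAt_comp_line {f : E → ℝ} {x v : E} {t : ℝ}
    (hf : DifferentiableAt ℝ f (x + t • v)) :
    HasDerivAt (fun s : ℝ => f (x + s • v)) (dirD v f (x + t • v)) t := by
  have h : HasDerivAt (fun s : ℝ => x + s • v) v t := by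
    simpa using ((hasDerivAt_id t).smul_const v).const_add x
  exact hasDerivAt_comp_curve hf h

lemma eventually_comp_line {P : E → Prop} {x : E} (v : E) (h : ∀ᶠ y in nhds x, P y) :
    ∀ᶠ t in nhds (0 : ℝ), P (x + t • v) := by
  have : Filter.Tendsto (fun t : ℝ => x + t • v) (nhds 0) (nhds x) := by
    have : Continuous fun t : ℝ => x + t • v := by fun_prop
    simpa using this.tendsto 0
  exact this.eventually h

lemma ContDiffAt.eventually_hasDerivAt_line {f : E → ℝ} {x : E}
    (hf : ContDiffAt ℝ (1 : ℕ) f x) (v : E) : ∀ᶠ t in nhds (0 : ℝ),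
      HasDerivAt (fun s : ℝ => f (x + s • v)) (_root_.dirD v f (x + t • v)) t :=
  (eventually_comp_line v (hf.eventually (by simp))).mono fun _ ht =>
    hasDerivAt_comp_line (ht.differentiableAt (by simp))

lemma dirD_dirD {f : E → ℝ} {x : E} (hf : ContDiffAt ℝ (2 : ℕ) f x) (v w : E) :
    dirD v (dirD w f) x = fderiv ℝ (fderiv ℝ f) x v w := by
  have h : DifferentiableAt ℝ (fderiv ℝ f) x :=
    (hf.fderiv_right (m := 1) (by norm_num)).differentiableAt (by simp)
  unfold dirD
  rw [fderiv_clm_apply h (differentiableAt_const w)]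
  simp

lemma dirD_comm {f : E → ℝ} {x : E} (hf : ContDiffAt ℝ (2 : ℕ) f x) (v w : E) :
    dirD v (dirD w f) x = dirD w (dirD v f) x := by
  rw [dirD_dirD hf, dirD_dirD hf]
  exact hf.isSymmSndFDerivAt (by simp) v w

lemma Filter.EventuallyEq.dirD {f g : E → ℝ} {x : E} (h : f =ᶠ[nhds x] g) (v : E) :
    _root_.dirD v f =ᶠ[nhds x] _root_.dirD v g :=
  h.fderiv.mono fun y hy => by unfold _root_.dirD; rw [hy]

lemma dirD_dirD_dirD_comm {f : E → ℝ} {x : E} (hf : ContDiffAt ℝ (3 : ℕ) f x) (v w : E) :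
    dirD v (dirD v (dirD w f)) x = dirD w (dirD v (dirD v f)) x := by
  have h1 : dirD v (dirD w f) =ᶠ[nhds x] dirD w (dirD v f) :=
    (hf.eventually (by simp)).mono fun y hy => dirD_comm (hy.of_le (by norm_num)) v w
  rw [(h1.dirD v).self_of_nhds]
  exact dirD_comm (hf.dirD v) v w

lemma dirD_dirD_comm_dirD_dirD {f : E → ℝ} {x : E} (hf : ContDiffAt ℝ (4 : ℕ) f x) (v w : E) :
    dirD v (dirD v (dirD w (dirD w f))) x = dirD w (dirD w (dirD v (dirD v f))) x := by
  have h1 : dirD v (dirD w (dirD w f)) =ᶠ[nhds x] dirD w (dirD w (dirD v f)) :=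
    (hf.eventually (by simp)).mono fun y hy =>
      (dirD_dirD_dirD_comm (hy.of_le (by norm_num)) w v).symm
  rw [(h1.dirD v).self_of_nhds]
  exact (dirD_dirD_dirD_comm (hf.dirD v) w v).symm

end DirectionalDerivatives

lemma pogorelov_at_max {ι E : Type*} [Fintype ι] [DecidableEq ι] [NormedAddCommGroup E]
    [NormedSpace ℝ E] (b : ι → E) (i₀ : ι) {u G η : E → ℝ} {x₀ : E} {lam : ι → ℝ} {β K : ℝ}
    (hu : ContDiffAt ℝ (4 : ℕ) u x₀) (hη : ContDiffAt ℝ (2 : ℕ) η x₀)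
    (hG : ContDiff ℝ (2 : ℕ) G)
    (hdet : ∀ᶠ x in nhds x₀, (Matrix.of fun i j => dirD (b i) (dirD (b j) u) x).det =
      Real.exp (G (∑ k, dirD (b k) u x • b k)))
    (hdiag : (Matrix.of fun i j => dirD (b i) (dirD (b j) u) x₀) = Matrix.diagonal lam)
    (hlam : ∀ i, 0 < lam i) (hηpos : 0 < η x₀)
    (hη2 : ∀ i, dirD (b i) (dirD (b i) η) x₀ = -lam i)
    (hmax : IsLocalMax (fun x => Real.log (η x) + Real.log (dirD (b i₀) (dirD (b i₀) u) x) +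
      β / 2 * ∑ k, dirD (b k) u x ^ 2) x₀)
    (hβ : 0 ≤ β) (he : ∀ i, |dirD (b i) η x₀| ≤ K) (ha : ∀ i, |dirD (b i) u x₀| ≤ K)
    (hc : ∀ i, |dirD (b i) G (∑ k, dirD (b k) u x₀ • b k)| ≤ K)
    (hd : 1 ≤ β + dirD (b i₀) (dirD (b i₀) G) (∑ k, dirD (b k) u x₀ • b k)) :
    η x₀ * lam i₀ ≤ Fintype.card ι * (1 + K ^ 2 + 2 * β * K ^ 2) + K := by
  have hu1 := fun i => (hu.dirD (b i) : ContDiffAt ℝ (3 : ℕ) _ x₀)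
  have hu2 := fun i j => ((hu1 j).dirD (b i) : ContDiffAt ℝ (2 : ℕ) _ x₀)
  have hu3 := fun i j k => ((hu2 j k).dirD (b i) : ContDiffAt ℝ (1 : ℕ) _ x₀)
  have hdg : ∀ i j, dirD (b i) (dirD (b j) u) x₀ = if i = j then lam i else 0 := fun i j => by
    have := congrFun (congrFun hdiag i) j
    rwa [Matrix.of_apply, Matrix.diagonal_apply] at this
  set q := ∑ k, dirD (b k) u x₀ • b k with hq
  have hgrad : ∀ l, ∀ᶠ t in nhds (0 : ℝ),
      HasDerivAt (fun s : ℝ => ∑ k, dirD (b k) u (x₀ + s • b l) • b k)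
        (∑ k, dirD (b l) (dirD (b k) u) (x₀ + t • b l) • b k) t := fun l => by
    have := Filter.eventually_all.2 fun k =>
      ((hu1 k).of_le (by norm_num)).eventually_hasDerivAt_line (b l)
    filter_upwards [this] with t ht
    exact HasDerivAt.fun_sum fun k _ => (ht k).smul_const _
  have hgrad0 : ∀ l, HasDerivAt (fun s : ℝ => ∑ k, dirD (b k) u (x₀ + s • b l) • b k)
      (lam l • b l) 0 := fun l => by
    have := (hgrad l).self_of_nhds
    simpa [hdg] using this
  have hlog : ∀ l, lam l * dirD (b l) G q = ∑ i, dirD (b l) (dirD (b i) (dirD (b i) u)) x₀ / lam i ∧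
      (∑ k, dirD (b l) (dirD (b l) (dirD (b k) u)) x₀ * dirD (b k) G q +
        lam l ^ 2 * dirD (b l) (dirD (b l) G) q) =
      ∑ i, dirD (b l) (dirD (b l) (dirD (b i) (dirD (b i) u))) x₀ / lam i -
      ∑ i, ∑ j, dirD (b l) (dirD (b i) (dirD (b j) u)) x₀ *
        dirD (b l) (dirD (b j) (dirD (b i) u)) x₀ / (lam i * lam j) := fun l => by
    have h1 : ∀ᶠ t in nhds (0 : ℝ), HasDerivAt
        (fun s : ℝ => G (∑ k, dirD (b k) u (x₀ + s • b l) • b k))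
        (∑ k, dirD (b l) (dirD (b k) u) (x₀ + t • b l) *
          dirD (b k) G (∑ k, dirD (b k) u (x₀ + t • b l) • b k)) t := by
      filter_upwards [hgrad l] with t ht
      exact (hasDerivAt_comp_curve (hG.differentiable (by simp) _) ht).congr_deriv
        (dirD_sum_smul _ _ _ _)
    have h2 : HasDerivAt (fun t : ℝ => ∑ k, dirD (b l) (dirD (b k) u) (x₀ + t • b l) *
          dirD (b k) G (∑ k, dirD (b k) u (x₀ + t • b l) • b k))
        (∑ k, dirD (b l) (dirD (b l) (dirD (b k) u)) x₀ * dirD (b k) G q +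
        lam l ^ 2 * dirD (b l) (dirD (b l) G) q) 0 := by
      have hGk : ∀ k, HasDerivAt
          (fun t : ℝ => dirD (b k) G (∑ k, dirD (b k) u (x₀ + t • b l) • b k))
          (lam l * dirD (b l) (dirD (b k) G) q) 0 := fun k => by
        have hd1 : DifferentiableAt ℝ (dirD (b k) G)
            (∑ k, dirD (b k) u (x₀ + (0 : ℝ) • b l) • b k) :=
          (hG.contDiffAt.dirD (m := 1) (b k)).differentiableAt (by simp)
        refine (hasDerivAt_comp_curve hd1 (hgrad0 l)).congr_deriv ?_
        simp [dirD_smul, hq]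
      have hUk : ∀ k, HasDerivAt (fun t : ℝ => dirD (b l) (dirD (b k) u) (x₀ + t • b l))
          (dirD (b l) (dirD (b l) (dirD (b k) u)) x₀) 0 := fun k => by
        simpa using (((hu2 l k).of_le (by norm_num)).eventually_hasDerivAt_line (b l)).self_of_nhds
      refine (HasDerivAt.fun_sum (u := Finset.univ) fun k _ =>
        (hUk k).fun_mul (hGk k)).congr_deriv ?_
      simp only [zero_smul, add_zero, hdg, Finset.sum_add_distrib, ite_mul, zero_mul,
        Finset.sum_ite_eq, Finset.mem_univ, if_true, ← hq]
      ring
    have h3 := log_det_derivatives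
      (A := fun t : ℝ => Matrix.of fun i j => dirD (b i) (dirD (b j) u) (x₀ + t • b l))
      (A' := fun t : ℝ => Matrix.of fun i j =>
        dirD (b l) (dirD (b i) (dirD (b j) u)) (x₀ + t • b l))
      (A'' := Matrix.of fun i j => dirD (b l) (dirD (b l) (dirD (b i) (dirD (b j) u))) x₀)
      hlam (by simpa using hdiag)
      (Filter.eventually_all.2 fun i => Filter.eventually_all.2 fun j =>
        ((hu2 i j).of_le (by norm_num)).eventually_hasDerivAt_line (b l))
      (fun i j => by
        simpa using ((hu3 l i j).eventually_hasDerivAt_line (b l)).self_of_nhds)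
      h1 h2 (eventually_comp_line (b l) hdet)
    simpa [hdg, ← hq] using h3
  have hL := hlam i₀
  have hfs : ∀ i, dirD (b i) η x₀ / η x₀ + dirD (b i) (dirD (b i₀) (dirD (b i₀) u)) x₀ / lam i₀ +
      β * (dirD (b i) u x₀ * lam i) = 0 ∧
      -lam i / η x₀ - dirD (b i) η x₀ ^ 2 / η x₀ ^ 2 +
        dirD (b i) (dirD (b i) (dirD (b i₀) (dirD (b i₀) u))) x₀ / lam i₀
        - dirD (b i) (dirD (b i₀) (dirD (b i₀) u)) x₀ ^ 2 / lam i₀ ^ 2 +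
      β * (lam i ^ 2 + ∑ k, dirD (b k) u x₀ * dirD (b i) (dirD (b i) (dirD (b k) u)) x₀) ≤ 0 := by
    intro i
    have hline : IsLocalMax (fun t : ℝ => Real.log (η (x₀ + t • b i)) +
        Real.log (dirD (b i₀) (dirD (b i₀) u) (x₀ + t • b i)) +
        β / 2 * ∑ k, dirD (b k) u (x₀ + t • b i) ^ 2) 0 := by
      have := eventually_comp_line (b i) hmax
      simpa [IsLocalMax, IsMaxFilter] using this
    have e1 := (hη.of_le (m := (1 : ℕ)) (by norm_num)).eventually_hasDerivAt_line (b i)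
    have e1' : ∀ᶠ t in nhds (0 : ℝ), η (x₀ + t • b i) ≠ 0 :=
      eventually_comp_line (b i) (hη.continuousAt.eventually_ne hηpos.ne')
    have e2 := ((hu2 i₀ i₀).of_le (m := (1 : ℕ)) (by norm_num)).eventually_hasDerivAt_line (b i)
    have e2' : ∀ᶠ t in nhds (0 : ℝ), dirD (b i₀) (dirD (b i₀) u) (x₀ + t • b i) ≠ 0 :=
      eventually_comp_line (b i)
        ((hu2 i₀ i₀).continuousAt.eventually_ne (by simp [hdg, hL.ne']))
    have e3 := Filter.eventually_all.2 fun k =>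
      ((hu1 k).of_le (m := (1 : ℕ)) (by norm_num)).eventually_hasDerivAt_line (b i)
    have f1 := ((hη.dirD (m := 1) (b i)).eventually_hasDerivAt_line (b i)).self_of_nhds
    have f2 := ((hu3 i i₀ i₀).eventually_hasDerivAt_line (b i)).self_of_nhds
    have f3 := fun k =>
      (((hu2 i k).of_le (m := (1 : ℕ)) (by norm_num)).eventually_hasDerivAt_line (b i)).self_of_nhds
    have hD1 : ∀ᶠ t in nhds (0 : ℝ), HasDerivAt
        (fun t : ℝ => Real.log (η (x₀ + t • b i)) +
          Real.log (dirD (b i₀) (dirD (b i₀) u) (x₀ + t • b i)) +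
          β / 2 * ∑ k, dirD (b k) u (x₀ + t • b i) ^ 2)
        (dirD (b i) η (x₀ + t • b i) / η (x₀ + t • b i) +
          dirD (b i) (dirD (b i₀) (dirD (b i₀) u)) (x₀ + t • b i) /
            dirD (b i₀) (dirD (b i₀) u) (x₀ + t • b i) +
          β * ∑ k, dirD (b k) u (x₀ + t • b i) * dirD (b i) (dirD (b k) u) (x₀ + t • b i)) t := by
      filter_upwards [e1, e1', e2, e2', e3] with t h1 h1' h2 h2' h3
      refine (((h1.log h1').fun_add (h2.log h2')).fun_add
        ((HasDerivAt.fun_sum (u := Finset.univ) fun k _ =>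
          (h3 k).fun_pow 2).const_mul (β / 2))).congr_deriv ?_
      rw [Finset.mul_sum, Finset.mul_sum]
      congr 1
      exact Finset.sum_congr rfl fun k _ => by push_cast; ring
    have hD2 := ((f1.fun_div e1.self_of_nhds e1'.self_of_nhds).fun_add
      (f2.fun_div e2.self_of_nhds e2'.self_of_nhds)).fun_add
        ((HasDerivAt.fun_sum (u := Finset.univ) fun k _ =>
          (e3.self_of_nhds k).fun_mul (f3 k)).const_mul β)
    obtain ⟨r1, r2⟩ := hline.second_deriv_nonpos hD1 hD2
    simp only [zero_smul, add_zero, hdg, if_true, hη2, mul_ite, mul_zero, ite_mul, zero_mul,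
      Finset.sum_add_distrib, Finset.sum_ite_eq, Finset.mem_univ] at r1 r2
    refine ⟨r1, le_trans (le_of_eq ?_) r2⟩
    field_simp
    ring
  refine pogorelov_algebra i₀ (lam := lam) (e := fun i => dirD (b i) η x₀)
    (a := fun i => dirD (b i) u x₀) (c := fun i => dirD (b i) G q)
    (S := fun i => dirD (b i) (dirD (b i₀) (dirD (b i₀) u)) x₀)
    (Q := fun i => dirD (b i) (dirD (b i) (dirD (b i₀) (dirD (b i₀) u))) x₀)
    (V := fun i j => dirD (b i₀) (dirD (b i) (dirD (b j) u)) x₀)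
    (W := fun i k => dirD (b i) (dirD (b i) (dirD (b k) u)) x₀)
    hlam hηpos hβ hd he ha hc ?_ ?_ (fun i => (hfs i).1) (fun i => (hfs i).2) ?_ ?_
  · intro i j
    have h1 : dirD (b i) (dirD (b j) u) =ᶠ[nhds x₀] dirD (b j) (dirD (b i) u) :=
      (hu.eventually (by simp)).mono fun y hy => dirD_comm (hy.of_le (by norm_num)) _ _
    exact (h1.dirD _).self_of_nhds
  · exact fun i => dirD_comm ((hu1 i₀).of_le (by norm_num)) _ _
  · intro l
    rw [(hlog l).1]
    exact Finset.sum_congr rfl fun i _ => by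
      rw [dirD_dirD_dirD_comm (hu.of_le (by norm_num))]
  · have h := (hlog i₀).2
    rw [add_comm] at h
    simp only [dirD_dirD_comm_dirD_dirD hu _ (b i₀)]
    rw [← h]
    congr 1
    exact Finset.sum_congr rfl fun i _ => by
      rw [dirD_dirD_dirD_comm (hu.of_le (by norm_num))]

section OrthonormalBases

variable {ι E : Type*} [Fintype ι] [NormedAddCommGroup E] [InnerProductSpace ℝ E]

/-- The value of a diagonal form on a unit vector is at most the largest eigenvalue. -/
lemma apply_le_of_diagonal (b : OrthonormalBasis ι ℝ E) {lam : ι → ℝ} {i₀ : ι}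
    (B : E →L[ℝ] E →L[ℝ] ℝ) (hb : ∀ i v, B (b i) v = lam i * inner ℝ (b i) v)
    (hi₀ : ∀ i, lam i ≤ lam i₀) {v : E} (hv : ‖v‖ = 1) : B v v ≤ lam i₀ := by
  have h1 : B v v = ∑ i, lam i * (inner ℝ (b i) v) ^ 2 := by
    have h : B v v = B (∑ i, inner ℝ (b i) v • b i) v := by rw [b.sum_repr']
    rw [h, map_sum, sum_apply]
    refine Finset.sum_congr rfl fun i _ => ?_
    rw [map_smul, smul_apply, hb, smul_eq_mul]
    ring
  have h2 : ∑ i, (inner ℝ (b i) v) ^ 2 = 1 := by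
    have := b.sum_sq_norm_inner_right v
    simpa [hv] using this
  rw [h1]
  calc ∑ i, lam i * (inner ℝ (b i) v) ^ 2 ≤ ∑ i, lam i₀ * (inner ℝ (b i) v) ^ 2 := by
        gcongr with i; exact hi₀ i
    _ = lam i₀ := by rw [← Finset.mul_sum, h2, mul_one]

variable [CompleteSpace E]

lemma sum_dirD_smul_eq_gradient (b : OrthonormalBasis ι ℝ E) (f : E → ℝ) (x : E) :
    ∑ k, dirD (b k) f x • b k = gradient f x := by
  rw [← b.sum_repr' (gradient f x)]
  refine Finset.sum_congr rfl fun k _ => ?_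
  rw [real_inner_comm, gradient, InnerProductSpace.toDual_symm_apply, dirD]

lemma norm_gradient_eq (f : E → ℝ) (x : E) : ‖gradient f x‖ = ‖fderiv ℝ f x‖ := by
  simp [gradient]

lemma sum_dirD_sq (b : OrthonormalBasis ι ℝ E) (f : E → ℝ) (x : E) :
    ∑ k, dirD (b k) f x ^ 2 = ‖fderiv ℝ f x‖ ^ 2 := by
  rw [← norm_gradient_eq, ← b.sum_sq_norm_inner_right (gradient f x)]
  refine Finset.sum_congr rfl fun k _ => ?_
  rw [real_inner_comm, gradient, InnerProductSpace.toDual_symm_apply, dirD, Real.norm_eq_abs,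
    sq_abs]

/-- A symmetric bilinear form is diagonal in some orthonormal basis. -/
lemma exists_orthonormalBasis_diagonal {n : ℕ} [FiniteDimensional ℝ E]
    (hn : Module.finrank ℝ E = n) (B : E →L[ℝ] E →L[ℝ] ℝ) (hB : ∀ v w, B v w = B w v) :
    ∃ (b : OrthonormalBasis (Fin n) ℝ E) (lam : Fin n → ℝ),
      ∀ i v, B (b i) v = lam i * inner ℝ (b i) v := by
  let T : E →ₗ[ℝ] E :=
    ((InnerProductSpace.toDual ℝ E).symm.toLinearEquiv.toLinearMap).comp B.toLinearMap
  have hT : ∀ v w, inner ℝ (T v) w = B v w := fun v w =>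
    InnerProductSpace.toDual_symm_apply
  have hS : T.IsSymmetric := fun v w => by
    rw [hT, real_inner_comm, hT, hB]
  refine ⟨hS.eigenvectorBasis hn, hS.eigenvalues hn, fun i v => ?_⟩
  rw [← hT, hS.apply_eigenvectorBasis, inner_smul_left]
  simp

end OrthonormalBases

/-- The determinant of the Hessian does not depend on the orthonormal basis. -/
lemma det_dirD_eq_det_pd2 {n : ℕ} {u : Eu n → ℝ} {x : Eu n} (hu : ContDiffAt ℝ (2 : ℕ) u x)
    (b : OrthonormalBasis (Fin n) ℝ (Eu n)) :
    (Matrix.of fun i j => dirD (b i) (dirD (b j) u) x).det =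
      (Matrix.of fun i j => pd2 u i j x).det := by
  set a := EuclideanSpace.basisFun (Fin n) ℝ
  set P := a.toBasis.toMatrix b with hP
  have hpd : (Matrix.of fun i j => pd2 u i j x) =
      Matrix.of fun i j => dirD (a i) (dirD (a j) u) x := by
    ext i j
    simp only [Matrix.of_apply, a, EuclideanSpace.basisFun_apply]
    rfl
  have hb : ∀ i, b i = ∑ k, P k i • a k := fun i => by
    have := a.toBasis.sum_toMatrix_smul_self (fun i => b i) i
    simpa using this.symm
  have hN : (Matrix.of fun i j => dirD (b i) (dirD (b j) u) x) =
      P.transpose * (Matrix.of fun i j => pd2 u i j x) * P := by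
    rw [hpd]
    ext i j
    simp only [Matrix.of_apply, Matrix.mul_apply, Matrix.transpose_apply, dirD_dirD hu]
    rw [hb i, hb j]
    simp only [map_sum, map_smul, sum_apply, smul_apply,
      smul_eq_mul, Finset.sum_mul, Finset.mul_sum]
    exact Finset.sum_congr rfl fun k _ => Finset.sum_congr rfl fun l _ => by ring
  have hdetP : P.det * P.det = 1 := by
    rcases a.det_to_matrix_orthonormalBasis_real b with h | h <;>
      rw [Module.Basis.det_apply] at h <;> rw [hP, h] <;> norm_num
  rw [hN, Matrix.det_mul, Matrix.det_mul, Matrix.det_transpose]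
  linear_combination (Matrix.of fun i j => pd2 u i j x).det * hdetP

section ConvexFunctions

variable {E : Type*} [NormedAddCommGroup E] [NormedSpace ℝ E]

lemma ConvexOn.comp_line {f : E → ℝ} {s : Set E} (hf : ConvexOn ℝ s f) {x v : E} {I : Set ℝ}
    (hI : Convex ℝ I) (hs : ∀ t ∈ I, x + t • v ∈ s) : ConvexOn ℝ I fun t => f (x + t • v) := by
  refine ⟨hI, fun p hp q hq a b ha hb hab => ?_⟩
  have h := hf.2 (hs p hp) (hs q hq) ha hb hab
  convert h using 2
  have : x = (a + b) • x := by rw [hab, one_smul]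
  conv_lhs => rw [this]
  simp only [smul_eq_mul]
  module

lemma ConvexOn.dirD_dirD_nonneg {f : E → ℝ} {s : Set E} (hf : ConvexOn ℝ s f) {x : E}
    (hs : s ∈ nhds x) (hfx : ContDiffAt ℝ (2 : ℕ) f x) (v : E) : 0 ≤ dirD v (dirD v f) x := by
  have hfx1 : ContDiffAt ℝ (1 : ℕ) f x := hfx.of_le (by norm_num)
  have key : ∀ w, (∀ᶠ t in nhds (0 : ℝ),
      HasDerivAt (fun s : ℝ => f (x + s • w)) (dirD w f (x + t • w)) t) ∧
      HasDerivAt (fun s : ℝ => dirD w f (x + s • w)) (dirD w (dirD w f) x) 0 := fun w =>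
    ⟨hfx1.eventually_hasDerivAt_line w, by
      simpa using ((hfx.dirD (m := 1) w).eventually_hasDerivAt_line w).self_of_nhds⟩
  have hmax : IsLocalMax (fun t : ℝ => -(f (x + t • v) + f (x + t • (-v)))) 0 := by
    filter_upwards [eventually_comp_line v hs, eventually_comp_line (-v) hs] with t h1 h2
    have h := hf.2 h1 h2 (show (0 : ℝ) ≤ 1 / 2 by norm_num) (show (0 : ℝ) ≤ 1 / 2 by norm_num)
      (by norm_num)
    have : (1 / 2 : ℝ) • (x + t • v) + (1 / 2 : ℝ) • (x + t • (-v)) = x := by module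
    rw [this] at h
    simp only [zero_smul, add_zero, smul_eq_mul] at h ⊢
    linarith
  have h := hmax.second_deriv_nonpos
    (by filter_upwards [(key v).1, (key (-v)).1] with t h1 h2 using (h1.fun_add h2).fun_neg)
    ((key v).2.fun_add (key (-v)).2).fun_neg
  have hneg : dirD (-v) (dirD (-v) f) x = dirD v (dirD v f) x := by
    rw [dirD_dirD hfx, dirD_dirD hfx]; simp
  rw [hneg] at h
  linarith [h.2]

lemma ConvexOn.dirD_le {f : E → ℝ} {s : Set E} (hf : ConvexOn ℝ s f) {x v : E} {r : ℝ} (hr : 0 < r)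
    (hs : ∀ t ∈ Set.Icc 0 r, x + t • v ∈ s) (hfx : DifferentiableAt ℝ f x) :
    dirD v f x ≤ (f (x + r • v) - f x) / r := by
  have h1 := hf.comp_line (convex_Icc 0 r) hs
  have h2 : HasDerivAt (fun t : ℝ => f (x + t • v)) (dirD v f x) 0 := by
    simpa using hasDerivAt_comp_line (f := f) (x := x) (v := v) (t := 0) (by simpa using hfx)
  have := h1.le_slope_of_hasDerivAt (x := 0) (y := r) ⟨le_rfl, hr.le⟩ ⟨hr.le, le_rfl⟩ hr h2
  simpa [slope_def_field] using this

lemma second_difference_le {f : E → ℝ} {x ξ : E} {ε M : ℝ} (hε : 0 < ε)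
    (hf : ∀ t ∈ Set.Icc (-ε) ε, ContDiffAt ℝ (2 : ℕ) f (x + t • ξ))
    (hM : ∀ t ∈ Set.Icc (-ε) ε, dirD ξ (dirD ξ f) (x + t • ξ) ≤ M) :
    f (x + ε • ξ) + f (x - ε • ξ) - 2 * f x ≤ M * ε ^ 2 := by
  have h1 : ∀ t ∈ Set.Icc (-ε) ε, HasDerivAt (fun t : ℝ => M / 2 * t ^ 2 - f (x + t • ξ))
      (M * t - dirD ξ f (x + t • ξ)) t := fun t ht => by
    refine (((hasDerivAt_pow 2 t).const_mul (M / 2)).fun_sub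
      (hasDerivAt_comp_line ((hf t ht).differentiableAt (by simp)))).congr_deriv ?_
    push_cast; ring
  have h2 : ∀ t ∈ Set.Icc (-ε) ε, HasDerivAt (fun t : ℝ => M * t - dirD ξ f (x + t • ξ))
      (M - dirD ξ (dirD ξ f) (x + t • ξ)) t := fun t ht => by
    refine (((hasDerivAt_id t).const_mul M).fun_sub (hasDerivAt_comp_line
      (((hf t ht).dirD (m := 1) ξ).differentiableAt (by simp)))).congr_deriv ?_
    ring
  have hconv : ConvexOn ℝ (Set.Icc (-ε) ε) (fun t : ℝ => M / 2 * t ^ 2 - f (x + t • ξ)) :=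
    convexOn_of_hasDerivWithinAt2_nonneg (convex_Icc _ _)
      (fun t ht => (h1 t ht).continuousAt.continuousWithinAt)
      (fun t ht => (h1 t (interior_subset ht)).hasDerivWithinAt)
      (fun t ht => (h2 t (interior_subset ht)).hasDerivWithinAt)
      (fun t ht => sub_nonneg.2 (hM t (interior_subset ht)))
  have h := hconv.2 (show ε ∈ Set.Icc (-ε) ε by constructor <;> linarith)
    (show -ε ∈ Set.Icc (-ε) ε by constructor <;> linarith) (show (0 : ℝ) ≤ 1 / 2 by norm_num)
    (show (0 : ℝ) ≤ 1 / 2 by norm_num) (by norm_num)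
  have h0 : (1 / 2 : ℝ) • ε + (1 / 2 : ℝ) • (-ε) = 0 := by simp
  rw [h0] at h
  simp only [smul_eq_mul, zero_smul, add_zero, neg_smul, ← sub_eq_add_neg] at h
  nlinarith

end ConvexFunctions

/-- Values and gradients of a nonnegative convex function on the unit ball. -/
lemma ConvexOn.exists_bounds {n : ℕ} {u : Eu n → ℝ}
    (hconv : ConvexOn ℝ (Metric.closedBall (0 : Eu n) 1) u)
    (hcont : ContinuousOn u (Metric.closedBall (0 : Eu n) 1)) (hu0 : u 0 = 0)
    (hnonneg : ∀ x ∈ Metric.closedBall (0 : Eu n) 1, 0 ≤ u x) :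
    ∃ m : ℝ, 0 ≤ m ∧ (∀ x ∈ Metric.closedBall (0 : Eu n) 1, u x ≤ m * ‖x‖) ∧
      ∀ x, ‖x‖ ≤ 1 / 2 → DifferentiableAt ℝ u x → ‖fderiv ℝ u x‖ ≤ 2 * m := by
  obtain ⟨m, hm⟩ := (isCompact_closedBall (0 : Eu n) 1).bddAbove_image hcont
  have hm' : ∀ x ∈ Metric.closedBall (0 : Eu n) 1, u x ≤ m := fun x hx =>
    hm (Set.mem_image_of_mem _ hx)
  have hm0 : 0 ≤ m := by simpa [hu0] using hm' 0 (by simp)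
  refine ⟨m, hm0, fun x hx => ?_, fun x hx hd => ?_⟩
  · rcases eq_or_ne x 0 with rfl | hx0
    · simp [hu0]
    have hn : 0 < ‖x‖ := norm_pos_iff.2 hx0
    have hx1 : ‖x‖ ≤ 1 := by simpa using hx
    have hy : ‖x‖⁻¹ • x ∈ Metric.closedBall (0 : Eu n) 1 := by
      simp [norm_smul, hn.ne']
    have h := hconv.2 hy (Metric.mem_closedBall_self zero_le_one) hn.le (sub_nonneg.2 hx1)
      (by ring)
    rw [smul_inv_smul₀ hn.ne', smul_zero, add_zero, hu0, smul_zero, add_zero, smul_eq_mul] at h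
    calc u x ≤ ‖x‖ * u (‖x‖⁻¹ • x) := h
      _ ≤ ‖x‖ * m := by gcongr; exact hm' _ hy
      _ = m * ‖x‖ := mul_comm _ _
  · have hxb : x ∈ Metric.closedBall (0 : Eu n) 1 := by simp; linarith
    have key : ∀ v : Eu n, ‖v‖ = 1 → fderiv ℝ u x v ≤ 2 * m := fun v hv => by
      have hs : ∀ t ∈ Set.Icc (0 : ℝ) (1 / 2), x + t • v ∈ Metric.closedBall (0 : Eu n) 1 :=
        fun t ht => by
          rw [mem_closedBall_zero_iff]
          refine (norm_add_le _ _).trans ?_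
          rw [norm_smul, hv, Real.norm_of_nonneg ht.1]
          linarith [ht.2]
      have h := hconv.dirD_le (by norm_num) hs hd
      have h1 := hm' _ (hs (1 / 2) ⟨by norm_num, le_rfl⟩)
      have h2 := hnonneg x hxb
      unfold dirD at h
      linarith
    refine ContinuousLinearMap.opNorm_le_of_unit_norm (by positivity) fun v hv => ?_
    rw [Real.norm_eq_abs, abs_le]
    have h1 := key v hv
    have h2 := key (-v) (by simpa using hv)
    rw [map_neg] at h2
    constructor <;> linarith

set_option maxHeartbeats 400000 in
/-- Pogorelov's estimate: the Hessian of a convex solution of the Monge-Ampère equation with a point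
singularity at the origin is bounded by a multiple of the inverse distance to the origin. -/
theorem exists_hessian_bound {n : ℕ} (hn : 2 ≤ n)
    {g : Eu n → ℝ} (hg : ContDiff ℝ 2 g) (hgpos : ∀ p, 0 < g p) {u : Eu n → ℝ}
    (hconv : ConvexOn ℝ (Metric.closedBall (0 : Eu n) 1) u)
    (hcont : ContinuousOn u (Metric.closedBall (0 : Eu n) 1)) (hu0 : u 0 = 0)
    (hnonneg : ∀ x ∈ Metric.closedBall (0 : Eu n) 1, 0 ≤ u x)
    (hC4 : ContDiffOn ℝ 4 u (Metric.ball (0 : Eu n) 1 \ {0}))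
    (heq : ∀ x ∈ Metric.ball (0 : Eu n) 1 \ {0},
      (Matrix.of fun i j => pd2 u i j x).det = g (gradient u x)) :
    ∃ C : ℝ, 0 < C ∧ ∀ x : Eu n, x ≠ 0 → ‖x‖ ≤ 1 / 2 → ∀ ξ : Eu n, ‖ξ‖ = 1 →
      ‖x‖ * dirD ξ (dirD ξ u) x ≤ C := by
  obtain ⟨m, hm0, hum, hgrad⟩ := hconv.exists_bounds hcont hu0 hnonneg
  set U := Metric.ball (0 : Eu n) 1 \ {0} with hU
  have hUo : IsOpen U := Metric.isOpen_ball.sdiff isClosed_singleton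
  have hUmem : ∀ x : Eu n, x ≠ 0 → ‖x‖ ≤ 1 / 2 → x ∈ U := fun x hx hx2 =>
    ⟨by rw [mem_ball_zero_iff]; linarith, hx⟩
  have hu4 : ∀ x ∈ U, ContDiffAt ℝ (4 : ℕ) u x := fun x hx =>
    hC4.contDiffAt (hUo.mem_nhds hx)
  have hu2 : ∀ x ∈ U, ContDiffAt ℝ (2 : ℕ) u x := fun x hx => (hu4 x hx).of_le (by norm_num)
  have hfd : ∀ x ∈ U, ContDiffAt ℝ (1 : ℕ) (fderiv ℝ u) x := fun x hx =>
    (hu2 x hx).fderiv_right (m := (1 : ℕ)) (by norm_num)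
  have hfdd : ∀ x ∈ U, ContinuousAt (fderiv ℝ (fderiv ℝ u)) x := fun x hx =>
    ((hfd x hx).fderiv_right (m := (0 : ℕ)) (by norm_num)).continuousAt
  have hnorm : Continuous fun B : Eu n →L[ℝ] Eu n →L[ℝ] ℝ => ‖B‖ :=
    continuous_norm (E := Eu n →L[ℝ] Eu n →L[ℝ] ℝ)
  obtain ⟨H, hH⟩ : ∃ H : ℝ, ∀ x : Eu n, ‖x‖ = 1 / 2 → ∀ v : Eu n, ‖v‖ = 1 →
      fderiv ℝ (fderiv ℝ u) x v v ≤ H := by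
    obtain ⟨H, hH⟩ := (isCompact_sphere (0 : Eu n) (1 / 2)).bddAbove_image
      (f := fun x => ‖fderiv ℝ (fderiv ℝ u) x‖) (fun x hx => by
        have hx' : ‖x‖ = 1 / 2 := by simpa using hx
        have hx0 : x ≠ 0 := norm_pos_iff.1 (by rw [hx']; norm_num)
        have hc : ContinuousAt (fun x => ‖fderiv ℝ (fderiv ℝ u) x‖) x :=
          hnorm.continuousAt.comp (hfdd x (hUmem x hx0 hx'.le))
        exact hc.continuousWithinAt)
    refine ⟨H, fun x hx v hv => ?_⟩
    have h1 : ‖fderiv ℝ (fderiv ℝ u) x‖ ≤ H := hH (Set.mem_image_of_mem _ (by simpa using hx))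
    have h2 := (fderiv ℝ (fderiv ℝ u) x).le_opNorm₂ v v
    rw [hv, mul_one, mul_one] at h2
    exact (le_abs_self _).trans (h2.trans h1)
  set G : Eu n → ℝ := fun p => Real.log (g p) with hGdef
  have hG : ContDiff ℝ (2 : ℕ) G := hg.log fun p => (hgpos p).ne'
  obtain ⟨K₁, hK₁0, hK₁⟩ : ∃ K₁ : ℝ, 0 ≤ K₁ ∧ ∀ q : Eu n, ‖q‖ ≤ 2 * m → ∀ v : Eu n, ‖v‖ = 1 →
      |dirD v G q| ≤ K₁ ∧ -K₁ ≤ dirD v (dirD v G) q := by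
    have hG1 : ContDiff ℝ (1 : ℕ) (fderiv ℝ G) := hG.fderiv_right (by norm_num)
    have hG2 : Continuous (fderiv ℝ (fderiv ℝ G)) := hG1.continuous_fderiv (by simp)
    obtain ⟨K₁, h⟩ := (isCompact_closedBall (0 : Eu n) (2 * m)).bddAbove_image
      (f := fun q => ‖fderiv ℝ G q‖ + ‖fderiv ℝ (fderiv ℝ G) q‖)
      (hG1.continuous.norm.fun_add (hnorm.comp hG2)).continuousOn
    have h' : ∀ q : Eu n, ‖q‖ ≤ 2 * m → ‖fderiv ℝ G q‖ + ‖fderiv ℝ (fderiv ℝ G) q‖ ≤ K₁ :=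
      fun q hq => h (Set.mem_image_of_mem _ (by simpa using hq))
    refine ⟨K₁, le_trans (by positivity) (h' 0 (by simpa using hm0)), fun q hq v hv => ⟨?_, ?_⟩⟩
    · have h1 := (fderiv ℝ G q).le_opNorm v
      rw [hv, mul_one, Real.norm_eq_abs] at h1
      unfold dirD
      linarith [h' q hq, norm_nonneg (fderiv ℝ (fderiv ℝ G) q)]
    · rw [dirD_dirD hG.contDiffAt]
      have h1 := (fderiv ℝ (fderiv ℝ G) q).le_opNorm₂ v v
      rw [hv, mul_one, mul_one, Real.norm_eq_abs] at h1
      linarith [h' q hq, norm_nonneg (fderiv ℝ G q), neg_abs_le (fderiv ℝ (fderiv ℝ G) q v v)]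
  set β := K₁ + 1 with hβ
  set K := 3 * m + 1 + K₁ with hK
  set C₀ := (n : ℝ) * (1 + K ^ 2 + 2 * β * K ^ 2) + K with hC₀
  have hβ0 : 0 ≤ β := by positivity
  have hC₀pos : 0 < C₀ := by positivity
  set C₁ := max C₀ ((m + 1) * H) with hC₁
  have hC₁pos : 0 < C₁ := lt_max_of_lt_left hC₀pos
  set N := Real.exp (β / 2 * (2 * m) ^ 2) with hN
  refine ⟨2 * (C₁ * N), by positivity, fun x hx0 hx2 ξ hξ => ?_⟩
  have hxpos : 0 < ‖x‖ := norm_pos_iff.2 hx0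
  set p : Eu n := ((m + 1) / ‖x‖) • x with hp
  have hpn : ‖p‖ = m + 1 := by
    rw [hp, norm_smul, Real.norm_of_nonneg (by positivity)]; field_simp
  set η : Eu n → ℝ := fun y => inner ℝ p y - ‖x‖ / 2 - u y with hη
  have hηx : ‖x‖ / 2 ≤ η x := by
    have h1 : inner ℝ p x = (m + 1) * ‖x‖ := by
      rw [hp, real_inner_smul_left, real_inner_self_eq_norm_sq]; field_simp
    have h2 := hum x (by simp; linarith)
    simp only [hη, h1]; linarith
  have hηle : ∀ y : Eu n, ‖y‖ ≤ 1 / 2 → η y ≤ m + 1 := fun y hy => by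
    have h1 := real_inner_le_norm p y
    have h2 := hnonneg y (by simp; linarith)
    have h3 : ‖p‖ * ‖y‖ ≤ (m + 1) * 1 := by rw [hpn]; gcongr; linarith
    simp only [hη]; linarith
  set S : Set (Eu n) := {y ∈ Metric.closedBall (0 : Eu n) (1 / 2) | 0 ≤ η y} with hS
  have hηcont : ContinuousOn η (Metric.closedBall (0 : Eu n) (1 / 2)) := by
    refine ContinuousOn.sub (by fun_prop)
      (hcont.mono (Metric.closedBall_subset_closedBall (by norm_num)))
  have hSc : IsCompact S :=
    (isCompact_closedBall _ _).of_isClosed_subset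
      (hηcont.preimage_isClosed_of_isClosed Metric.isClosed_closedBall isClosed_Ici)
      Set.inter_subset_left
  have hSU : ∀ y ∈ S, y ∈ U := fun y hy => by
    refine hUmem y ?_ (by simpa using hy.1)
    rintro rfl
    have := hy.2
    simp only [hη, hu0, inner_zero_right] at this
    linarith
  set F : Eu n × Eu n → ℝ := fun z =>
    η z.1 * fderiv ℝ (fderiv ℝ u) z.1 z.2 z.2 * Real.exp (β / 2 * ‖fderiv ℝ u z.1‖ ^ 2) with hF
  have hFc : ContinuousOn F (S ×ˢ Metric.sphere (0 : Eu n) 1) := by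
    have hf1 : ContinuousOn (fun z : Eu n × Eu n => z.1) (S ×ˢ Metric.sphere (0 : Eu n) 1) :=
      continuousOn_fst
    have hmaps : Set.MapsTo (fun z : Eu n × Eu n => z.1) (S ×ˢ Metric.sphere (0 : Eu n) 1) S :=
      fun z hz => hz.1
    have c1 := (hηcont.mono (Set.inter_subset_left (t := {y | 0 ≤ η y}))).comp hf1 hmaps
    have c2 := (ContinuousOn.comp (t := S) (g := fderiv ℝ (fderiv ℝ u))
      (fun y hy => (hfdd y (hSU y hy)).continuousWithinAt) hf1 hmaps)
    have c3 := (ContinuousOn.comp (t := S) (g := fderiv ℝ u)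
      (fun y hy => (hfd y (hSU y hy)).continuousAt.continuousWithinAt) hf1 hmaps)
    refine (c1.mul ((c2.clm_apply continuousOn_snd).clm_apply continuousOn_snd)).mul ?_
    exact Real.continuous_exp.comp_continuousOn (continuousOn_const.mul (c3.norm.pow 2))
  obtain ⟨⟨y₀, v₀⟩, ⟨hy₀, hv₀⟩, hmax⟩ := (hSc.prod (isCompact_sphere (0 : Eu n) 1)).exists_isMaxOn
    ⟨(x, ξ), ⟨by simpa using hx2, by linarith⟩, by simpa using hξ⟩ hFc
  have hmax' : ∀ y ∈ S, ∀ v : Eu n, ‖v‖ = 1 → F (y, v) ≤ F (y₀, v₀) := fun y hy v hv =>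
    hmax ⟨hy, by simpa using hv⟩
  simp only at hy₀ hv₀
  have hv₀' : ‖v₀‖ = 1 := by simpa using hv₀
  have hy₀2 : ‖y₀‖ ≤ 1 / 2 := by simpa using hy₀.1
  have hy₀U := hSU y₀ hy₀
  have hgrad' : ∀ y ∈ U, ‖y‖ ≤ 1 / 2 → ‖fderiv ℝ u y‖ ≤ 2 * m := fun y hy hy2 =>
    hgrad y hy2 ((hu2 y hy).differentiableAt (by simp))
  have hpsd : ∀ y ∈ U, ∀ v, 0 ≤ fderiv ℝ (fderiv ℝ u) y v v := fun y hy v => by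
    rw [← dirD_dirD (hu2 y hy)]
    exact hconv.dirD_dirD_nonneg (Metric.closedBall_mem_nhds_of_mem hy.1) (hu2 y hy) v
  suffices hmain : η y₀ * fderiv ℝ (fderiv ℝ u) y₀ v₀ v₀ ≤ C₁ by
    have hFxle : F (x, ξ) ≤ C₁ * N := by
      refine (hmax' x ⟨by simpa using hx2, by linarith⟩ ξ hξ).trans ?_
      simp only [hF, hN]
      have := hgrad' y₀ hy₀U hy₀2
      gcongr
    have hxU := hUmem x hx0 hx2
    have h1 : η x * fderiv ℝ (fderiv ℝ u) x ξ ξ ≤ F (x, ξ) := by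
      refine le_mul_of_one_le_right (mul_nonneg (by linarith) (hpsd x hxU ξ)) ?_
      exact Real.one_le_exp (by positivity)
    have h2 : ‖x‖ / 2 * fderiv ℝ (fderiv ℝ u) x ξ ξ ≤ η x * fderiv ℝ (fderiv ℝ u) x ξ ξ :=
      mul_le_mul_of_nonneg_right hηx (hpsd x hxU ξ)
    rw [dirD_dirD (hu2 x hxU)]
    linarith
  rcases hy₀.2.eq_or_lt with hη0 | hηpos
  · rw [← hη0, zero_mul]; exact hC₁pos.le
  rcases hy₀2.eq_or_lt with hbd | hint
  · refine le_trans ?_ (le_max_right _ _)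
    exact mul_le_mul (hηle y₀ hy₀2) (hH y₀ hbd v₀ hv₀') (hpsd y₀ hy₀U v₀) (by positivity)
  refine le_trans ?_ (le_max_left _ _)
  obtain ⟨b, lam, hb⟩ := exists_orthonormalBasis_diagonal (n := n) (by simp)
    (fderiv ℝ (fderiv ℝ u) y₀) fun v w => (hu2 y₀ hy₀U).isSymmSndFDerivAt (by simp) v w
  have hdiag : (Matrix.of fun i j => dirD (b i) (dirD (b j) u) y₀) = Matrix.diagonal lam := by
    ext i j
    rw [Matrix.of_apply, dirD_dirD (hu2 y₀ hy₀U), hb, b.inner_eq_ite, Matrix.diagonal_apply]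
    split_ifs <;> simp
  have hBlam : ∀ i, fderiv ℝ (fderiv ℝ u) y₀ (b i) (b i) = lam i := fun i => by
    rw [hb, b.inner_eq_one, mul_one]
  have hdet : ∀ y ∈ U, (Matrix.of fun i j => dirD (b i) (dirD (b j) u) y).det =
      Real.exp (G (∑ k, dirD (b k) u y • b k)) := fun y hy => by
    rw [det_dirD_eq_det_pd2 (hu2 y hy), heq y hy, sum_dirD_smul_eq_gradient, hGdef,
      Real.exp_log (hgpos _)]
  have hlam : ∀ i, 0 < lam i := fun i => by
    refine lt_of_le_of_ne (hBlam i ▸ hpsd y₀ hy₀U (b i)) fun h0 => ?_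
    have h := hdet y₀ hy₀U
    rw [hdiag, Matrix.det_diagonal, Finset.prod_eq_zero (Finset.mem_univ i) h0.symm] at h
    exact (Real.exp_pos _).ne h
  have : Nonempty (Fin n) := ⟨⟨0, by omega⟩⟩
  obtain ⟨i₀, hi₀⟩ := Finite.exists_max lam
  have hBv : fderiv ℝ (fderiv ℝ u) y₀ v₀ v₀ ≤ lam i₀ := apply_le_of_diagonal b _ hb hi₀ hv₀'
  refine (mul_le_mul_of_nonneg_left hBv hηpos.le).trans ?_
  have hηC : ContDiffAt ℝ (2 : ℕ) η y₀ :=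
    ((contDiff_const.inner ℝ contDiff_id).contDiffAt.sub contDiffAt_const).sub (hu2 y₀ hy₀U)
  have hdη : ∀ v, ∀ y ∈ U, dirD v η y = inner ℝ p v - dirD v u y := fun v y hy => by
    have h1 : HasFDerivAt (fun y : Eu n => inner ℝ p y - ‖x‖ / 2) (innerSL ℝ p) y :=
      (innerSL ℝ p).hasFDerivAt.sub_const _
    have h2 := h1.sub ((hu2 y hy).differentiableAt (by simp)).hasFDerivAt
    unfold dirD
    rw [show fderiv ℝ η y = _ from h2.fderiv]
    simp
  have hUn : ∀ᶠ y in nhds y₀, y ∈ U := hUo.mem_nhds hy₀U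
  have hfy₀ := hgrad' y₀ hy₀U hy₀2
  have hunit : ∀ i, |dirD (b i) u y₀| ≤ 2 * m := fun i => by
    have h1 := (fderiv ℝ u y₀).le_opNorm (b i)
    rw [b.norm_eq_one, mul_one, Real.norm_eq_abs] at h1
    exact h1.trans hfy₀
  have hq : ‖∑ k, dirD (b k) u y₀ • b k‖ ≤ 2 * m := by
    rw [sum_dirD_smul_eq_gradient, norm_gradient_eq]; exact hfy₀
  have hfinal := pogorelov_at_max (fun i => b i) i₀ (G := G) (η := η) (lam := lam) (β := β) (K := K)
    (hu4 y₀ hy₀U) hηC hG (hUn.mono hdet) hdiag hlam hηpos (fun i => ?_) ?_ hβ0 (fun i => ?_)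
    (fun i => (hunit i).trans (by linarith))
    (fun i => ((hK₁ _ hq (b i) (b.norm_eq_one i)).1).trans (by linarith))
    (by linarith [(hK₁ _ hq (b i₀) (b.norm_eq_one i₀)).2])
  · simpa [hC₀] using hfinal
  · have h1 : dirD (b i) η =ᶠ[nhds y₀] fun y => inner ℝ p (b i) - dirD (b i) u y :=
      hUn.mono (hdη (b i))
    rw [(h1.dirD (b i)).self_of_nhds, ← hBlam, ← dirD_dirD (hu2 y₀ hy₀U)]
    simp only [dirD, fderiv_const_sub]
    rfl
  · have hpos : ∀ᶠ y in nhds y₀, 0 < fderiv ℝ (fderiv ℝ u) y (b i₀) (b i₀) := by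
      have hc : ContinuousAt (fun y => fderiv ℝ (fderiv ℝ u) y (b i₀) (b i₀)) y₀ :=
        ((hfdd y₀ hy₀U).clm_apply continuousAt_const).clm_apply continuousAt_const
      exact hc.eventually (lt_mem_nhds ((hlam i₀).trans_eq (hBlam i₀).symm))
    have hηev : ∀ᶠ y in nhds y₀, 0 < η y := hηC.continuousAt.eventually (lt_mem_nhds hηpos)
    have hball : ∀ᶠ y in nhds y₀, ‖y‖ < 1 / 2 :=
      continuous_norm.continuousAt.eventually_lt_const hint
    have hlogF : ∀ y ∈ U, 0 < η y → 0 < fderiv ℝ (fderiv ℝ u) y (b i₀) (b i₀) →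
        Real.log (η y) + Real.log (dirD (b i₀) (dirD (b i₀) u) y) +
          β / 2 * ∑ k, dirD (b k) u y ^ 2 = Real.log (F (y, b i₀)) := fun y hy h1 h2 => by
      simp only [hF]
      rw [Real.log_mul (mul_pos h1 h2).ne' (Real.exp_pos _).ne', Real.log_mul h1.ne' h2.ne',
        Real.log_exp, sum_dirD_sq, dirD_dirD (hu2 y hy)]
    filter_upwards [hUn, hpos, hηev, hball] with y hyU hyB hyη hyb
    rw [hlogF y hyU hyη hyB, hlogF y₀ hy₀U hηpos (by rw [hBlam]; exact hlam i₀)]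
    refine Real.log_le_log (mul_pos (mul_pos hyη hyB) (Real.exp_pos _)) ?_
    refine (hmax' y ⟨by simpa using hyb.le, hyη.le⟩ _ (b.norm_eq_one i₀)).trans ?_
    simp only [hF]
    rw [hBlam]
    gcongr
  · rw [hdη _ y₀ hy₀U]
    have h1 := abs_real_inner_le_norm p (b i)
    rw [hpn, b.norm_eq_one, mul_one] at h1
    have h2 := abs_sub (inner ℝ p (b i)) (dirD (b i) u y₀)
    have := hunit i
    linarith

theorem stmt4 (n : ℕ) (hn : 2 ≤ n)
    (g : Eu n → ℝ) (hg : ContDiff ℝ 2 g) (hgpos : ∀ p, 0 < g p)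
    (u : Eu n → ℝ)
    -- u is convex and continuous on the closed unit ball, u(0) = 0, u > 0 away from 0
    (hconv : ConvexOn ℝ (Metric.closedBall (0 : Eu n) 1) u)
    (hcont : ContinuousOn u (Metric.closedBall (0 : Eu n) 1))
    (hu0 : u 0 = 0)
    (hupos : ∀ x ∈ Metric.closedBall (0 : Eu n) 1, x ≠ 0 → 0 < u x)
    -- u is strictly convex on B₁
    (hstrict : StrictConvexOn ℝ (Metric.ball (0 : Eu n) 1) u)
    -- u is C⁴ on B₁ ∖ {0} and solves det D²u = g(Du) there
    (hC4 : ContDiffOn ℝ 4 u (Metric.ball (0 : Eu n) 1 \ {0}))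
    (heq : ∀ x ∈ Metric.ball (0 : Eu n) 1 \ {0},
      (Matrix.of fun i j => pd2 u i j x).det = g (gradient u x))
    -- φ is a convex cone (positively 1-homogeneous) tangent to u at 0
    (φ : Eu n → ℝ) (hφconv : ConvexOn ℝ Set.univ φ)
    (hφhom : ∀ t : ℝ, 0 < t → ∀ x : Eu n, φ (t • x) = t * φ x)
    (hφle : ∀ x ∈ Metric.ball (0 : Eu n) 1, φ x ≤ u x)
    (htangent : Filter.Tendsto (fun x : Eu n => (u x - φ x) / ‖x‖)
      (nhdsWithin 0 (Metric.ball (0 : Eu n) 1 \ {0})) (nhds 0)) :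
    -- second-difference form of |x|·|D²φ(x)| ≤ C
    ∃ C : ℝ, 0 < C ∧ ∀ x : Eu n, x ≠ 0 → ∀ ξ : Eu n, ‖ξ‖ = 1 →
      ∀ ε : ℝ, 0 < ε → ε ≤ ‖x‖ / 2 →
        φ (x + ε • ξ) + φ (x - ε • ξ) - 2 * φ x ≤ C * ε ^ 2 / ‖x‖ := by
  have hnonneg : ∀ x ∈ Metric.closedBall (0 : Eu n) 1, 0 ≤ u x := fun x hx => by
    rcases eq_or_ne x 0 with rfl | h
    · exact hu0.ge
    · exact (hupos x hx h).le
  obtain ⟨C, hC, hbound⟩ :=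
    exists_hessian_bound hn hg hgpos hconv hcont hu0 hnonneg hC4 heq
  refine ⟨2 * C, by positivity, fun x hx ξ hξ ε hε hεx => ?_⟩
  have hxpos : 0 < ‖x‖ := norm_pos_iff.2 hx
  have hsmall : ∀ᶠ r : ℝ in nhdsWithin 0 (Set.Ioi 0), 0 < r ∧ r * ‖x‖ < 1 / 3 := by
    refine Filter.Eventually.and self_mem_nhdsWithin (nhdsWithin_le_nhds ?_)
    have : ContinuousAt (fun r : ℝ => r * ‖x‖) 0 := by fun_prop
    exact this.eventually_lt_const (by norm_num)
  have hray : Filter.Tendsto (fun r : ℝ => r • x) (nhdsWithin 0 (Set.Ioi 0))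
      (nhdsWithin 0 (Metric.ball (0 : Eu n) 1 \ {0})) := by
    refine tendsto_nhdsWithin_iff.2 ⟨?_, hsmall.mono fun r hr => ⟨?_, ?_⟩⟩
    · have : Continuous fun r : ℝ => r • x := by fun_prop
      simpa using (this.tendsto 0).mono_left nhdsWithin_le_nhds
    · rw [mem_ball_zero_iff, norm_smul, Real.norm_of_nonneg hr.1.le]
      linarith [hr.2]
    · exact smul_ne_zero hr.1.ne' hx
  have hlim : Filter.Tendsto
      (fun r : ℝ => 2 * C * ε ^ 2 / ‖x‖ + 2 * ‖x‖ * ((u (r • x) - φ (r • x)) / ‖r • x‖))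
      (nhdsWithin 0 (Set.Ioi 0)) (nhds (2 * C * ε ^ 2 / ‖x‖)) := by
    simpa using ((htangent.comp hray).const_mul (2 * ‖x‖)).const_add (2 * C * ε ^ 2 / ‖x‖)
  refine ge_of_tendsto hlim (hsmall.mono fun r ⟨hr, hrx⟩ => ?_)
  have hseg : ∀ t ∈ Set.Icc (-(r * ε)) (r * ε),
      r * ‖x‖ / 2 ≤ ‖r • x + t • ξ‖ ∧ ‖r • x + t • ξ‖ ≤ 1 / 2 := fun t ht => by
    have h1 : ‖r • x‖ = r * ‖x‖ := by rw [norm_smul, Real.norm_of_nonneg hr.le]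
    have h2 : ‖t • ξ‖ ≤ r * ‖x‖ / 2 := by
      rw [norm_smul, hξ, mul_one, Real.norm_eq_abs]
      refine (abs_le.2 ht).trans ?_
      linarith [mul_le_mul_of_nonneg_left hεx hr.le]
    have h3 := norm_add_le (r • x) (t • ξ)
    have h4 := norm_sub_le_norm_add (r • x) (t • ξ)
    constructor <;> linarith
  have hrxpos : 0 < r * ‖x‖ := by positivity
  have hu := second_difference_le (f := u) (x := r • x) (ξ := ξ) (ε := r * ε)
    (M := C / (r * ‖x‖ / 2)) (by positivity)
    (fun t ht => by
      obtain ⟨h1, h2⟩ := hseg t ht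
      refine (hC4.contDiffAt ((Metric.isOpen_ball.sdiff isClosed_singleton).mem_nhds
        ⟨?_, norm_pos_iff.1 (by linarith)⟩)).of_le (by norm_num)
      rw [mem_ball_zero_iff]; linarith)
    (fun t ht => by
      obtain ⟨h1, h2⟩ := hseg t ht
      have hpos : 0 < ‖r • x + t • ξ‖ := by linarith
      have h3 := hbound _ (norm_pos_iff.1 hpos) h2 ξ hξ
      calc _ ≤ C / ‖r • x + t • ξ‖ := by rwa [le_div_iff₀' hpos]
        _ ≤ C / (r * ‖x‖ / 2) := by gcongr)
  have hball : ∀ t ∈ Set.Icc (-(r * ε)) (r * ε), φ (r • x + t • ξ) ≤ u (r • x + t • ξ) :=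
    fun t ht => hφle _ (by rw [mem_ball_zero_iff]; linarith [(hseg t ht).2])
  have hrε : 0 ≤ r * ε := by positivity
  have h1 := hball (r * ε) ⟨by linarith, le_rfl⟩
  have h2 := hball (-(r * ε)) ⟨le_rfl, by linarith⟩
  rw [neg_smul, ← sub_eq_add_neg] at h2
  have e1 : φ (r • x + (r * ε) • ξ) = r * φ (x + ε • ξ) := by
    rw [← hφhom r hr, smul_add, smul_smul]
  have e2 : φ (r • x - (r * ε) • ξ) = r * φ (x - ε • ξ) := by
    rw [← hφhom r hr, smul_sub, smul_smul]
  have e3 : C / (r * ‖x‖ / 2) * (r * ε) ^ 2 = r * (2 * C * ε ^ 2 / ‖x‖) := by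
    field_simp
  have e4 : 2 * ‖x‖ * ((u (r • x) - φ (r • x)) / ‖r • x‖) = 2 * (u (r • x) - r * φ x) / r := by
    rw [norm_smul, Real.norm_of_nonneg hr.le, hφhom r hr]; field_simp
  rw [e4, ← sub_le_iff_le_add', le_div_iff₀ hr]
  rw [e3] at hu
  rw [e1] at h1
  rw [e2] at h2
  linarith
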